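/- Let w : ℝ × ℝ → ℝ be a smooth nowhere-zero function satisfying the KdV eigenfunction equation w_t = w_xxx − 3 w_x w_xx / w at every point, and let φ : ℝ × ℝ → ℝ be smooth with φ_x = w² at every point. Then the x-derivative of φ_t − φ_x {φ; x} vanishes identically on ℝ × ℝ, where {φ; x} = (φ_xx/φ_x)_x − (1/2)(φ_xx/φ_x)². -/

import Mathlib

/-- Partial derivative with respect to the first (space) variable. -/
noncomputable def px (f : ℝ × ℝ → ℝ) : ℝ × ℝ → ℝ :=
  fun p => deriv (fun x => f (x, p.2)) p.1

/-- Partial derivative with respect to the second (time) variable. -/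
noncomputable def pt (f : ℝ × ℝ → ℝ) : ℝ × ℝ → ℝ :=
  fun p => deriv (fun t => f (p.1, t)) p.2

/-- Schwarzian derivative of `f` with respect to the space variable:
`{f; x} = (f_xx / f_x)_x - (1/2) (f_xx / f_x)²`. -/
noncomputable def schwarz (f : ℝ × ℝ → ℝ) : ℝ × ℝ → ℝ :=
  fun p => px (fun q => px (px f) q / px f q) p - (1/2) * (px (px f) p / px f p) ^ 2


theorem px_eq_fderiv {f : ℝ × ℝ → ℝ} (hf : Differentiable ℝ f) (p : ℝ × ℝ) :
    px f p = fderiv ℝ f p (1, 0) :=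
  ((hf p).hasFDerivAt.comp_hasDerivAt p.1
    ((hasDerivAt_id p.1).prodMk (hasDerivAt_const p.1 p.2))).deriv

theorem pt_eq_fderiv {f : ℝ × ℝ → ℝ} (hf : Differentiable ℝ f) (p : ℝ × ℝ) :
    pt f p = fderiv ℝ f p (0, 1) :=
  ((hf p).hasFDerivAt.comp_hasDerivAt p.2
    ((hasDerivAt_const p.2 p.1).prodMk (hasDerivAt_id p.2))).deriv

theorem ContDiff.px {f : ℝ × ℝ → ℝ} (hf : ContDiff ℝ (⊤ : ℕ∞) f) :
    ContDiff ℝ (⊤ : ℕ∞) (px f) := by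
  rw [funext (px_eq_fderiv (hf.differentiable (by simp)))]
  exact (hf.fderiv_right (by simp)).clm_apply contDiff_const

theorem ContDiff.pt {f : ℝ × ℝ → ℝ} (hf : ContDiff ℝ (⊤ : ℕ∞) f) :
    ContDiff ℝ (⊤ : ℕ∞) (pt f) := by
  rw [funext (pt_eq_fderiv (hf.differentiable (by simp)))]
  exact (hf.fderiv_right (by simp)).clm_apply contDiff_const

theorem ContDiff.hasDerivAt_px {f : ℝ × ℝ → ℝ} (hf : ContDiff ℝ (⊤ : ℕ∞) f) (p : ℝ × ℝ) :
    HasDerivAt (fun x => f (x, p.2)) (_root_.px f p) p.1 :=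
  ((hf.differentiable (by simp)).comp
    (differentiable_id.prodMk (differentiable_const p.2)) p.1).hasDerivAt

theorem ContDiff.hasDerivAt_pt {f : ℝ × ℝ → ℝ} (hf : ContDiff ℝ (⊤ : ℕ∞) f) (p : ℝ × ℝ) :
    HasDerivAt (fun t => f (p.1, t)) (_root_.pt f p) p.2 :=
  ((hf.differentiable (by simp)).comp
    ((differentiable_const p.1).prodMk differentiable_id) p.2).hasDerivAt

/-- Partial derivatives of a smooth function commute. -/
theorem ContDiff.px_pt_comm {f : ℝ × ℝ → ℝ} (hf : ContDiff ℝ (⊤ : ℕ∞) f) (p : ℝ × ℝ) :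
    _root_.px (_root_.pt f) p = _root_.pt (_root_.px f) p := by
  have hd : Differentiable ℝ (fderiv ℝ f) :=
    (hf.fderiv_right (m := (⊤ : ℕ∞)) (by simp)).differentiable (by simp)
  have hsymm : IsSymmSndFDerivAt ℝ f p :=
    hf.contDiffAt.isSymmSndFDerivAt (by simp; exact WithTop.coe_le_coe.2 le_top)
  rw [px_eq_fderiv (hf.pt.differentiable (by simp)), pt_eq_fderiv (hf.px.differentiable (by simp)),
    funext (px_eq_fderiv (hf.differentiable (by simp))),
    funext (pt_eq_fderiv (hf.differentiable (by simp))),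
    fderiv_clm_apply (hd p) (differentiableAt_const _),
    fderiv_clm_apply (hd p) (differentiableAt_const _)]
  simpa using hsymm (1, 0) (0, 1)

/-- If `w` is smooth, nowhere zero, and satisfies the KdV eigenfunction equation, and `φ`
is smooth with `φ_x = w²`, then `(φ_t - φ_x {φ; x})_x = 0` identically. -/
theorem kdvEigenfunction_to_kdvSing_up_to_x_derivative
    (w : ℝ × ℝ → ℝ) (hw : ContDiff ℝ (⊤ : ℕ∞) w) (hw0 : ∀ p, w p ≠ 0)
    (heq : ∀ p, pt w p = px (px (px w)) p - 3 * px w p * px (px w) p / w p)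
    (φ : ℝ × ℝ → ℝ) (hφ : ContDiff ℝ (⊤ : ℕ∞) φ) (hB : ∀ p, px φ p = (w p) ^ 2) :
    ∀ p, px (fun q => pt φ q - px φ q * schwarz φ q) p = 0 := by
  have hpx : px φ = fun q => w q ^ 2 := funext hB
  have hpxx : px (px φ) = fun q => 2 * w q * px w q := by
    funext q
    rw [hpx]
    exact ((hw.hasDerivAt_px q).fun_pow 2).deriv.trans (by simp)
  have hquot : (fun q => px (px φ) q / px φ q) = fun q => 2 * px w q / w q := by
    funext q
    rw [hpxx, hpx]
    have := hw0 q
    field_simp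
  have hprod (q) : px φ q * schwarz φ q = 2 * w q * px (px w) q - 4 * px w q ^ 2 := by
    have h : px (fun q => 2 * px w q / w q) q =
        (2 * px (px w) q * w q - 2 * px w q * px w q) / w q ^ 2 :=
      (((hw.px.hasDerivAt_px q).const_mul 2).fun_div (hw.hasDerivAt_px q) (hw0 q)).deriv
    rw [schwarz, hquot, h, congrFun hquot q, hB]
    have := hw0 q
    field_simp
    ring
  have hmixed (p) : px (pt φ) p = 2 * w p * pt w p := by
    rw [hφ.px_pt_comm, hpx]
    exact ((hw.hasDerivAt_pt p).fun_pow 2).deriv.trans (by simp)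
  intro p
  simp only [hprod]
  have h := (hφ.pt.hasDerivAt_px p).fun_sub
    ((((hw.hasDerivAt_px p).const_mul 2).fun_mul (hw.px.px.hasDerivAt_px p)).fun_sub
      (((hw.px.hasDerivAt_px p).fun_pow 2).const_mul 4))
  refine h.deriv.trans ?_
  rw [hmixed, heq]
  have := hw0 p
  field_simp
  simp
  ring
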